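/- arXiv:1908.06455 — 2 statements merged into one kernel-verified Lean document; each statement's English description precedes it below -/
import Mathlib

section
/- Let n ≥ 1, let α = (α₁,…,αₙ) ∈ (0,π)ⁿ be a vector of non-exceptional angles, let ℓ ∈ (0,∞)ⁿ and σ ∈ ℝ. Then 1 is an eigenvalue of the transfer matrix T(α,ℓ,σ) if and only if F^P(α,ℓ,σ) = 0. (This is Theorem 2.15 for non-exceptional curvilinear polygons: σ ≥ 0 is a quasi-eigenvalue if and only if it is a root of the trigonometric polynomial F^P.) -/
open Matrix

/-- The vertex transfer matrix `A(α)` (for non-exceptional `α`). -/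
noncomputable def Amat (α : ℝ) : Matrix (Fin 2) (Fin 2) ℂ :=
  !![((Real.sin (Real.pi ^ 2 / (2 * α)))⁻¹ : ℂ),
      -Complex.I * ((Real.cos (Real.pi ^ 2 / (2 * α)) / Real.sin (Real.pi ^ 2 / (2 * α)) : ℝ) : ℂ);
      Complex.I * ((Real.cos (Real.pi ^ 2 / (2 * α)) / Real.sin (Real.pi ^ 2 / (2 * α)) : ℝ) : ℂ),
      ((Real.sin (Real.pi ^ 2 / (2 * α)))⁻¹ : ℂ)]

/-- The side transfer matrix `B(ℓ,σ) = diag(exp(iℓσ), exp(-iℓσ))`. -/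
noncomputable def Bmat (ℓ σ : ℝ) : Matrix (Fin 2) (Fin 2) ℂ :=
  !![Complex.exp (Complex.I * ((ℓ * σ : ℝ) : ℂ)), 0;
      0, Complex.exp (-(Complex.I * ((ℓ * σ : ℝ) : ℂ)))]

/-- `C(α,ℓ,σ) = A(α) · B(ℓ,σ)`. -/
noncomputable def Cmat (α ℓ σ : ℝ) : Matrix (Fin 2) (Fin 2) ℂ := Amat α * Bmat ℓ σ

/-- The transfer matrix `T(α,ℓ,σ) = C(αₙ,ℓₙ,σ) ⋯ C(α₁,ℓ₁,σ)`. -/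
noncomputable def Tmat {n : ℕ} (α ℓ : Fin n → ℝ) (σ : ℝ) : Matrix (Fin 2) (Fin 2) ℂ :=
  ((List.ofFn fun j => Cmat (α j) (ℓ j) σ).reverse).prod

/-- An angle is exceptional if it is of the form `π/(2k)` for a positive integer `k`. -/
def Exceptional (α : ℝ) : Prop := ∃ k : ℕ, 0 < k ∧ α = Real.pi / (2 * (k : ℝ))

/-- Cyclic successor on `Fin n`. -/
def cyc {n : ℕ} (j : Fin n) : Fin n :=
  ⟨(j.val + 1) % n, Nat.mod_lt _ (Nat.lt_of_le_of_lt (Nat.zero_le _) j.isLt)⟩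

/-- The sign vector `ζ ∈ {±1}ⁿ` encoded by `ε : Fin n → Bool`. -/
def sgnB {n : ℕ} (ε : Fin n → Bool) (j : Fin n) : ℝ := if ε j then 1 else -1

/-- Sign vectors `ζ ∈ {±1}ⁿ` with `ζ₁ = 1`. -/
def zSet (n : ℕ) : Finset (Fin n → Bool) :=
  Finset.univ.filter fun ε => ∀ j : Fin n, (j : ℕ) = 0 → ε j = true

/-- The dot product `ℓ · ζ`. -/
noncomputable def dotSgn {n : ℕ} (ℓ : Fin n → ℝ) (ε : Fin n → Bool) : ℝ :=
  ∑ j, ℓ j * sgnB ε j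

/-- `𝔭_ζ(α) = ∏_{j ∈ Ch(ζ)} cos(π²/(2α_j))`, where `Ch(ζ)` is the set of indices of sign change
of `ζ`, with the cyclic convention `ζ_{n+1} = ζ₁`. -/
noncomputable def pCoef {n : ℕ} (α : Fin n → ℝ) (ε : Fin n → Bool) : ℝ :=
  ∏ j ∈ Finset.univ.filter (fun j : Fin n => ε j ≠ ε (cyc j)),
    Real.cos (Real.pi ^ 2 / (2 * α j))

/-- `F_even(α,ℓ,σ) = Σ_{ζ ∈ {±1}ⁿ, ζ₁ = 1} 𝔭_ζ(α) cos((ℓ·ζ)σ)`. -/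
noncomputable def Feven {n : ℕ} (α ℓ : Fin n → ℝ) (σ : ℝ) : ℝ :=
  ∑ ε ∈ zSet n, pCoef α ε * Real.cos (dotSgn ℓ ε * σ)

/-- `F_odd(α,ℓ,σ) = Σ_{ζ ∈ {±1}ⁿ, ζ₁ = 1} 𝔭_ζ(α) sin((ℓ·ζ)σ)`. -/
noncomputable def Fodd {n : ℕ} (α ℓ : Fin n → ℝ) (σ : ℝ) : ℝ :=
  ∑ ε ∈ zSet n, pCoef α ε * Real.sin (dotSgn ℓ ε * σ)

/-- A product of matrices, expanded as a sum over paths with prescribed endpoints. -/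
theorem ofFn_reverse_prod_apply {ι R : Type*} [Fintype ι] [DecidableEq ι] [CommRing R] :
    ∀ (n : ℕ) (M : Fin n → Matrix ι ι R) (a b : ι),
      (List.ofFn M).reverse.prod a b =
        ∑ x : Fin (n + 1) → ι, if x 0 = b ∧ x (Fin.last n) = a then
          ∏ j : Fin n, M j (x j.succ) (x j.castSucc) else 0
  | 0, M, a, b => by
    rw [← (Equiv.funUnique (Fin 1) ι).symm.sum_comp]
    by_cases h : a = b
    · subst h
      simp
    · simp only [List.ofFn_zero, List.reverse_nil, List.prod_nil, Matrix.one_apply, if_neg h]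
      symm
      refine Finset.sum_eq_zero fun y _ => if_neg ?_
      rintro ⟨h1, h2⟩
      exact h (h2.symm.trans h1)
  | n + 1, M, a, b => by
    rw [List.ofFn_succ, List.reverse_cons, List.prod_append, List.prod_singleton,
      Matrix.mul_apply, ← (Fin.consEquiv fun _ => ι).sum_comp, Fintype.sum_prod_type]
    simp only [ofFn_reverse_prod_apply n, Finset.sum_mul, Fin.consEquiv_apply]
    rw [Finset.sum_comm, Finset.sum_comm (γ := ι)]
    refine Finset.sum_congr rfl fun y _ => ?_
    rw [Finset.sum_eq_single (y 0), Finset.sum_eq_single b]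
    · simp [Fin.prod_univ_succ, ← Fin.succ_last, mul_comm]
    · intro c _ hc
      simp [hc]
    · simp
    · intro c _ hc
      simp [hc.symm]
    · simp

theorem snoc_head_succ_eq_cyc {ι : Type*} {m : ℕ} (ε : Fin (m + 1) → ι) (j : Fin (m + 1)) :
    (Fin.snoc ε (ε 0) : Fin (m + 2) → ι) j.succ = ε (cyc j) := by
  refine Fin.lastCases ?_ (fun i => ?_) j
  · rw [Fin.succ_last, Fin.snoc_last]
    congr 1
    ext
    simp [cyc]
  · rw [Fin.succ_castSucc, Fin.snoc_castSucc]
    congr 1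
    ext
    simp [cyc, Nat.mod_eq_of_lt]

/-- The trace of a product of matrices is a sum over closed paths. -/
theorem trace_ofFn_reverse_prod {ι R : Type*} [Fintype ι] [DecidableEq ι] [CommRing R] {n : ℕ}
    (hn : 1 ≤ n) (M : Fin n → Matrix ι ι R) :
    (List.ofFn M).reverse.prod.trace = ∑ ε : Fin n → ι, ∏ j, M j (ε (cyc j)) (ε j) := by
  obtain ⟨m, rfl⟩ : ∃ m, n = m + 1 := ⟨n - 1, by omega⟩
  simp only [Matrix.trace, Matrix.diag, ofFn_reverse_prod_apply]
  simp only [← (Fin.snocEquiv fun _ : Fin (m + 2) => ι).sum_comp, Fintype.sum_prod_type]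
  rw [Finset.sum_congr rfl fun a _ => Finset.sum_comm, Finset.sum_comm]
  refine Finset.sum_congr rfl fun ε _ => ?_
  have h0 (c : ι) : (Fin.snoc ε c : Fin (m + 2) → ι) 0 = ε 0 :=
    Fin.snoc_castSucc (α := fun _ => ι) c ε 0
  simp only [Fin.snocEquiv_apply, h0, Fin.snoc_last]
  rw [Finset.sum_eq_single (ε 0), Finset.sum_eq_single (ε 0)]
  · simp only [and_self, if_true, snoc_head_succ_eq_cyc, Fin.snoc_castSucc]
  · intro c _ hc
    simp [hc]
  · simp
  · intro c _ hc
    simp [hc.symm]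
  · simp

theorem cyc_bijective {n : ℕ} : Function.Bijective (cyc : Fin n → Fin n) := by
  rw [← Finite.surjective_iff_bijective]
  intro j
  have hj := j.isLt
  by_cases h : j.val = 0
  · refine ⟨⟨n - 1, by omega⟩, Fin.ext ?_⟩
    have : n - 1 + 1 = n := by omega
    simp [cyc, this, h]
  · refine ⟨⟨j.val - 1, by omega⟩, Fin.ext ?_⟩
    have : j.val - 1 + 1 = j.val := by omega
    simp [cyc, this, Nat.mod_eq_of_lt hj]

/-- The matrix index corresponding to a sign: `+1` is the first one. -/
def signIndex : Bool ≃ Fin 2 := Equiv.boolNot.trans finTwoEquiv.symm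

/-- The phase factor that makes the vertex transfer matrix symmetric. -/
noncomputable def signPhase (a : Bool) : ℂ := if a then 1 else Complex.I

theorem signPhase_ne_zero (a : Bool) : signPhase a ≠ 0 := by
  cases a <;> simp [signPhase]

theorem Cmat_signIndex (α ℓ σ : ℝ) (a b : Bool) :
    Cmat α ℓ σ (signIndex a) (signIndex b) =
      signPhase a / signPhase b * ((Real.sin (Real.pi ^ 2 / (2 * α)) : ℝ) : ℂ)⁻¹ *
        (((if b ≠ a then Real.cos (Real.pi ^ 2 / (2 * α)) else 1 : ℝ) : ℂ) *
          Complex.exp (Complex.I * ((ℓ * (if b then 1 else -1) * σ : ℝ) : ℂ))) := by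
  have ht : signIndex true = 0 := rfl
  have hf : signIndex false = 1 := rfl
  cases a <;> cases b <;>
    simp [ht, hf, Cmat, Amat, Bmat, signPhase, Matrix.mul_apply, Fin.sum_univ_two] <;> ring

theorem trace_Tmat {n : ℕ} (hn : 1 ≤ n) (α ℓ : Fin n → ℝ) (σ : ℝ) :
    (Tmat α ℓ σ).trace = ((∏ j, Real.sin (Real.pi ^ 2 / (2 * α j)) : ℝ) : ℂ)⁻¹ *
      ∑ ε : Fin n → Bool, (pCoef α ε : ℂ) *
        Complex.exp (Complex.I * ((dotSgn ℓ ε * σ : ℝ) : ℂ)) := by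
  rw [Tmat, trace_ofFn_reverse_prod hn, 
    ← (Equiv.arrowCongr (Equiv.refl (Fin n)) signIndex).sum_comp,
    Finset.mul_sum]
  refine Finset.sum_congr rfl fun ε _ => ?_
  have hg : ∏ j, signPhase (ε (cyc j)) / signPhase (ε j) = 1 := by
    rw [Finset.prod_div_distrib, cyc_bijective.prod_comp fun j => signPhase (ε j)]
    exact div_self (Finset.prod_ne_zero_iff.mpr fun j _ => signPhase_ne_zero _)
  simp only [Equiv.arrowCongr_apply, Equiv.refl_symm, Equiv.coe_refl, Function.comp_apply, id_eq,
    Cmat_signIndex, Finset.prod_mul_distrib, hg, one_mul, Finset.prod_inv_distrib,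
    ← Complex.exp_sum, ← Finset.mul_sum, ← Complex.ofReal_prod, ← Complex.ofReal_sum,
    ← Finset.sum_mul]
  rw [pCoef, Finset.prod_filter]
  rfl

theorem pCoef_not {n : ℕ} (α : Fin n → ℝ) (ε : Fin n → Bool) :
    pCoef α (fun j => !ε j) = pCoef α ε := by
  simp [pCoef]

theorem dotSgn_not {n : ℕ} (ℓ : Fin n → ℝ) (ε : Fin n → Bool) :
    dotSgn ℓ (fun j => !ε j) = -dotSgn ℓ ε := by
  rw [dotSgn, dotSgn, ← Finset.sum_neg_distrib]
  refine Finset.sum_congr rfl fun j _ => ?_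
  cases h : ε j <;> simp [sgnB, h]

theorem mem_zSet_iff {n : ℕ} (hn : 1 ≤ n) (ε : Fin n → Bool) : ε ∈ zSet n ↔ ε ⟨0, hn⟩ = true := by
  simp only [zSet, Finset.mem_filter, Finset.mem_univ, true_and]
  refine ⟨fun h => h _ rfl, fun h j hj => ?_⟩
  rwa [show j = ⟨0, hn⟩ from Fin.ext hj]

/-- A sum over all sign vectors, folded onto those with first sign `+1`. -/
theorem sum_eq_sum_zSet_add_not {n : ℕ} (hn : 1 ≤ n) {R : Type*} [AddCommMonoid R]
    (f : (Fin n → Bool) → R) :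
    ∑ ε, f ε = ∑ ε ∈ zSet n, (f ε + f fun j => !ε j) := by
  rw [Finset.sum_add_distrib, ← Finset.sum_add_sum_compl (zSet n)]
  congr 1
  refine Finset.sum_nbij' (fun ε j => !ε j) (fun ε j => !ε j) ?_ ?_ ?_ ?_ ?_ <;>
    simp [mem_zSet_iff hn]

theorem sum_pCoef_mul_exp {n : ℕ} (hn : 1 ≤ n) (α ℓ : Fin n → ℝ) (σ : ℝ) :
    ∑ ε : Fin n → Bool, (pCoef α ε : ℂ) * Complex.exp (Complex.I * ((dotSgn ℓ ε * σ : ℝ) : ℂ)) =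
      2 * (Feven α ℓ σ : ℂ) := by
  rw [sum_eq_sum_zSet_add_not hn, Feven, Complex.ofReal_sum, Finset.mul_sum]
  refine Finset.sum_congr rfl fun ε _ => ?_
  rw [pCoef_not, dotSgn_not, Complex.ofReal_mul (pCoef α ε), Complex.ofReal_cos, Complex.cos,
    mul_comm Complex.I, mul_comm Complex.I, neg_mul (dotSgn ℓ ε), Complex.ofReal_neg]
  ring

theorem sin_ne_zero_of_not_exceptional {α : ℝ} (h0 : 0 < α) (h : ¬ Exceptional α) :
    Real.sin (Real.pi ^ 2 / (2 * α)) ≠ 0 := by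
  rw [Real.sin_ne_zero_iff]
  intro k hk
  have hπ := Real.pi_pos
  have hα : Real.pi = 2 * α * k := by
    field_simp at hk
    linarith
  have hk0 : (0 : ℝ) < k := by
    by_contra hle
    nlinarith
  lift k to ℕ using by exact_mod_cast hk0.le
  push_cast at hα hk0
  refine h ⟨k, by exact_mod_cast hk0, ?_⟩
  rw [eq_div_iff (by positivity), hα]
  ring

theorem det_Cmat {α : ℝ} (ℓ σ : ℝ) (h : Real.sin (Real.pi ^ 2 / (2 * α)) ≠ 0) :
    (Cmat α ℓ σ).det = 1 := by
  have hB : (Bmat ℓ σ).det = 1 := by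
    simp [Bmat, Matrix.det_fin_two, ← Complex.exp_add]
  have hA : (Amat α).det = 1 := by
    have h2 := Real.sin_sq_add_cos_sq (Real.pi ^ 2 / (2 * α))
    rw [Amat, Matrix.det_fin_two_of]
    generalize Real.sin (Real.pi ^ 2 / (2 * α)) = s at *
    generalize Real.cos (Real.pi ^ 2 / (2 * α)) = c at *
    have h3 : (s : ℂ) ^ 2 + (c : ℂ) ^ 2 = 1 := by exact_mod_cast h2
    have hs : (s : ℂ) ≠ 0 := by exact_mod_cast h
    push_cast
    field_simp
    linear_combination (c : ℂ) ^ 2 * Complex.I_sq - h3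
  rw [Cmat, Matrix.det_mul, hA, hB, one_mul]

theorem det_Tmat {n : ℕ} (α ℓ : Fin n → ℝ) (σ : ℝ)
    (h : ∀ j, Real.sin (Real.pi ^ 2 / (2 * α j)) ≠ 0) : (Tmat α ℓ σ).det = 1 := by
  rw [Tmat, ← Matrix.coe_detMonoidHom, map_list_prod]
  refine List.prod_eq_one fun x hx => ?_
  simp only [List.map_reverse, List.mem_reverse, List.mem_map, List.mem_ofFn] at hx
  obtain ⟨_, ⟨j, rfl⟩, rfl⟩ := hx
  exact det_Cmat _ _ (h j)

/-- A `2 × 2` matrix of determinant `1` has eigenvalue `1` iff its trace is `2`. -/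
theorem exists_mulVec_eq_self_iff_trace {K : Type*} [Field K] (M : Matrix (Fin 2) (Fin 2) K)
    (h : M.det = 1) : (∃ v : Fin 2 → K, v ≠ 0 ∧ M.mulVec v = v) ↔ M.trace = 2 := by
  have key : (M - 1).det = 2 - M.trace := by
    rw [Matrix.det_fin_two] at h ⊢
    rw [Matrix.trace_fin_two]
    simp
    linear_combination h
  have := Matrix.exists_mulVec_eq_zero_iff (M := M - 1)
  simp only [Matrix.sub_mulVec, Matrix.one_mulVec, sub_eq_zero] at this
  rw [this, key, sub_eq_zero, eq_comm]

/-- **Theorem 2.15 (non-exceptional case).** For a non-exceptional curvilinear polygon, `1` is an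
eigenvalue of the transfer matrix `T(α,ℓ,σ)` iff `F^P(α,ℓ,σ) = F_even(α,ℓ,σ) - ∏ sin(π²/(2α_j))`
vanishes. -/
theorem stmt3 (n : ℕ) (hn : 1 ≤ n) (α ℓ : Fin n → ℝ)
    (hα : ∀ j, α j ∈ Set.Ioo 0 Real.pi ∧ ¬ Exceptional (α j))
    (hℓ : ∀ j, 0 < ℓ j) (σ : ℝ) :
    (∃ v : Fin 2 → ℂ, v ≠ 0 ∧ (Tmat α ℓ σ).mulVec v = v) ↔
      Feven α ℓ σ - ∏ j, Real.sin (Real.pi ^ 2 / (2 * α j)) = 0 := by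
  have hs : ∀ j, Real.sin (Real.pi ^ 2 / (2 * α j)) ≠ 0 := fun j =>
    sin_ne_zero_of_not_exceptional (hα j).1.1 (hα j).2
  have hP : ((∏ j, Real.sin (Real.pi ^ 2 / (2 * α j)) : ℝ) : ℂ) ≠ 0 :=
    Complex.ofReal_ne_zero.mpr (Finset.prod_ne_zero_iff.mpr fun j _ => hs j)
  rw [exists_mulVec_eq_self_iff_trace _ (det_Tmat α ℓ σ hs), trace_Tmat hn, sum_pCoef_mul_exp hn,
    inv_mul_eq_iff_eq_mul₀ hP, mul_comm, mul_left_inj' two_ne_zero, Complex.ofReal_inj, sub_eq_zero]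
end

section
/- Let L > 0, K ≥ 0 and c₀ > 0. There exist constants C > 0 and δ > 0, depending only on K, L and c₀, with the following property. Let q, q̃ : [0,L] → ℝ² be three times continuously differentiable unit-speed curves with signed curvatures γ, γ̃, suppose |γ(s)| ≤ K for all s, suppose the chord–arc bounds |q(s) − q(s')| ≥ c₀|s − s'| and |q̃(s) − q̃(s')| ≥ c₀|s − s'| hold for all s, s' ∈ [0,L], and set Γ₁ = sup_{s}|γ(s) − γ̃(s)| + sup_{s}|γ'(s) − γ̃'(s)|. If Γ₁ ≤ δ, then for all s ≠ s' in [0,L]: | log|q(s) − q(s')| − log|q̃(s) − q̃(s')| | ≤ CΓ₁|s − s'|². (This is the bound (8.19) of Proposition 8.9 on the difference of single-layer potential kernels K_{SL} − K_{S̃L} on on-diagonal rectangles; its proof also establishes the intermediate estimate | |q(s)−q(s')|² − |q̃(s)−q̃(s')|² | ≤ CΓ₁|s − s'|⁴ after aligning q'(s') = q̃'(s').) -/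
/-- Rotation of `ℝ²` by the angle `π/2`. -/
def rot2 (v : ℝ × ℝ) : ℝ × ℝ := (-v.2, v.1)

/-- The Euclidean inner product on `ℝ²`. -/
def dot2 (u v : ℝ × ℝ) : ℝ := u.1 * v.1 + u.2 * v.2

/-- The Euclidean norm on `ℝ²`. -/
noncomputable def enorm2 (v : ℝ × ℝ) : ℝ := Real.sqrt (v.1 ^ 2 + v.2 ^ 2)

/-- The signed curvature of a unit-speed plane curve `q`, i.e. the function `γ` determined by
`q''(s) = γ(s)·Rot(q'(s))`. -/
noncomputable def curv (q : ℝ → ℝ × ℝ) (s : ℝ) : ℝ :=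
  dot2 (iteratedDeriv 2 q s) (rot2 (deriv q s))

theorem hasDerivAt_deriv_fst_snd {q : ℝ → ℝ × ℝ} (hq : ContDiff ℝ 3 q) (s : ℝ) :
    HasDerivAt (fun t => (deriv q t).1) (iteratedDeriv 2 q s).1 s ∧
      HasDerivAt (fun t => (deriv q t).2) (iteratedDeriv 2 q s).2 s := by
  have h1 : ContDiff ℝ 2 (deriv q) := by
    have : ContDiff ℝ (2 + 1) q := by convert hq using 1; norm_num
    exact (contDiff_succ_iff_deriv.1 this).2.2
  have h2 : HasDerivAt (deriv q) (iteratedDeriv 2 q s) s := by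
    rw [iteratedDeriv_succ, iteratedDeriv_one]
    exact (h1.differentiable (by norm_num) s).hasDerivAt
  exact ⟨h2.fst, h2.snd⟩

theorem hasDerivAt_fst_snd {q : ℝ → ℝ × ℝ} (hq : ContDiff ℝ 3 q) (s : ℝ) :
    HasDerivAt (fun t => (q t).1) (deriv q s).1 s ∧
      HasDerivAt (fun t => (q t).2) (deriv q s).2 s := by
  have h := (hq.differentiable (by norm_num) s).hasDerivAt
  exact ⟨h.fst, h.snd⟩

theorem continuous_curv {q : ℝ → ℝ × ℝ} (hq : ContDiff ℝ 3 q) : Continuous (curv q) := by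
  have h1 : Continuous (deriv q) := hq.continuous_deriv (by norm_num)
  have h2 : Continuous (iteratedDeriv 2 q) := hq.continuous_iteratedDeriv 2 (by norm_num)
  unfold curv dot2 rot2
  fun_prop

theorem sq_add_sq_eq_one_of_enorm2 {v : ℝ × ℝ} (h : enorm2 v = 1) : v.1 ^ 2 + v.2 ^ 2 = 1 := by
  simpa [enorm2] using h

/-- The Frenet equation `q'' = γ·Rot(q')`, in coordinates. -/
theorem iteratedDeriv_two_eq_curv {L : ℝ} (hL : 0 < L) {q : ℝ → ℝ × ℝ} (hq : ContDiff ℝ 3 q)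
    (hu : ∀ s ∈ Set.Icc (0 : ℝ) L, enorm2 (deriv q s) = 1) {s : ℝ} (hs : s ∈ Set.Icc (0 : ℝ) L) :
    (iteratedDeriv 2 q s).1 = -(curv q s * (deriv q s).2) ∧
      (iteratedDeriv 2 q s).2 = curv q s * (deriv q s).1 := by
  obtain ⟨h1, h2⟩ := hasDerivAt_deriv_fst_snd hq s
  have hd := ((h1.pow 2).add (h2.pow 2)).hasDerivWithinAt (s := Set.Icc (0 : ℝ) L)
  have hd0 : HasDerivWithinAt (fun t => (deriv q t).1 ^ 2 + (deriv q t).2 ^ 2) 0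
      (Set.Icc (0 : ℝ) L) s :=
    (hasDerivWithinAt_const s _ (1 : ℝ)).congr_of_mem
      (fun t ht => sq_add_sq_eq_one_of_enorm2 (hu t ht)) hs
  have horth := (uniqueDiffOn_Icc hL s hs).eq_deriv _ hd hd0
  have h := sq_add_sq_eq_one_of_enorm2 (hu s hs)
  simp only [curv, dot2, rot2]
  norm_num at horth
  constructor
  · linear_combination (-(iteratedDeriv 2 q s).1) * h + (deriv q s).1 / 2 * horth
  · linear_combination (-(iteratedDeriv 2 q s).2) * h + (deriv q s).2 / 2 * horth

theorem eq_of_hasDerivWithinAt_zero {f : ℝ → ℝ} {S : Set ℝ} (hS : Convex ℝ S)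
    (hf : ∀ x ∈ S, HasDerivWithinAt f 0 S x) {a b : ℝ} (ha : a ∈ S) (hb : b ∈ S) : f a = f b := by
  have := hS.norm_image_sub_le_of_norm_hasDerivWithin_le (C := 0) hf (by simp) hb ha
  simpa [sub_eq_zero] using this

/-- The angle between two unit tangent vectors is the integral of the curvature. -/
theorem dot2_deriv_eq_cos {L : ℝ} (hL : 0 < L) {q : ℝ → ℝ × ℝ} (hq : ContDiff ℝ 3 q)
    (hu : ∀ s ∈ Set.Icc (0 : ℝ) L, enorm2 (deriv q s) = 1) {a b : ℝ}
    (ha : a ∈ Set.Icc (0 : ℝ) L) (hb : b ∈ Set.Icc (0 : ℝ) L) :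
    dot2 (deriv q a) (deriv q b) = Real.cos (∫ t in b..a, curv q t) := by
  have hθ (s : ℝ) : HasDerivAt (fun s => ∫ t in b..s, curv q t) (curv q s) s :=
    ((continuous_curv hq).integral_hasStrictDerivAt b s).hasDerivAt
  have hX := eq_of_hasDerivWithinAt_zero (convex_Icc (0 : ℝ) L)
    (f := fun s => (deriv q s).1 * Real.cos (∫ t in b..s, curv q t)
      + (deriv q s).2 * Real.sin (∫ t in b..s, curv q t)) (fun s hs => by
        obtain ⟨h1, h2⟩ := hasDerivAt_deriv_fst_snd hq s
        obtain ⟨e1, e2⟩ := iteratedDeriv_two_eq_curv hL hq hu hs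
        refine (((h1.mul (hθ s).cos).add (h2.mul (hθ s).sin)).congr_deriv ?_).hasDerivWithinAt
        rw [e1, e2]; ring) ha hb
  have hY := eq_of_hasDerivWithinAt_zero (convex_Icc (0 : ℝ) L)
    (f := fun s => (deriv q s).2 * Real.cos (∫ t in b..s, curv q t)
      - (deriv q s).1 * Real.sin (∫ t in b..s, curv q t)) (fun s hs => by
        obtain ⟨h1, h2⟩ := hasDerivAt_deriv_fst_snd hq s
        obtain ⟨e1, e2⟩ := iteratedDeriv_two_eq_curv hL hq hu hs
        refine (((h2.mul (hθ s).cos).sub (h1.mul (hθ s).sin)).congr_deriv ?_).hasDerivWithinAt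
        rw [e1, e2]; ring) ha hb
  simp only [intervalIntegral.integral_same, Real.cos_zero, Real.sin_zero] at hX hY
  have h := sq_add_sq_eq_one_of_enorm2 (hu a ha)
  simp only [dot2]
  linear_combination (-(deriv q a).1) * hX - (deriv q a).2 * hY
    + Real.cos (∫ t in b..a, curv q t) * h

theorem abs_cos_sub_cos_le (x y : ℝ) :
    |Real.cos x - Real.cos y| ≤ |x + y| * |x - y| / 2 := by
  rw [Real.cos_sub_cos, abs_mul, abs_mul]
  have h1 := Real.abs_sin_le_abs (x := (x + y) / 2)
  have h2 := Real.abs_sin_le_abs (x := (x - y) / 2)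
  rw [abs_div, abs_two] at h1 h2
  have h := mul_le_mul h1 h2 (abs_nonneg _) (by positivity)
  norm_num
  linarith

/-- Curves with close curvatures have close tangent correlations. -/
theorem abs_dot2_deriv_sub_le {L K Γ : ℝ} (hL : 0 < L) {q qt : ℝ → ℝ × ℝ}
    (hq : ContDiff ℝ 3 q) (hqt : ContDiff ℝ 3 qt)
    (hu : ∀ s ∈ Set.Icc (0 : ℝ) L, enorm2 (deriv q s) = 1)
    (hut : ∀ s ∈ Set.Icc (0 : ℝ) L, enorm2 (deriv qt s) = 1)
    (hK : ∀ s ∈ Set.Icc (0 : ℝ) L, |curv q s| ≤ K)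
    (hΓ : ∀ s ∈ Set.Icc (0 : ℝ) L, |curv q s - curv qt s| ≤ Γ) {a b : ℝ}
    (ha : a ∈ Set.Icc (0 : ℝ) L) (hb : b ∈ Set.Icc (0 : ℝ) L) :
    |dot2 (deriv q a) (deriv q b) - dot2 (deriv qt a) (deriv qt b)|
      ≤ (2 * K + Γ) / 2 * Γ * |a - b| ^ 2 := by
  have hi := (continuous_curv hq).intervalIntegrable (μ := MeasureTheory.volume) b a
  have hit := (continuous_curv hqt).intervalIntegrable (μ := MeasureTheory.volume) b a
  have hsub : Set.uIoc b a ⊆ Set.Icc 0 L :=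
    Set.uIoc_subset_uIcc.trans (Set.uIcc_subset_Icc hb ha)
  have hm : |(∫ t in b..a, curv q t) - ∫ t in b..a, curv qt t| ≤ Γ * |a - b| := by
    rw [← intervalIntegral.integral_sub hi hit]
    refine (Real.norm_eq_abs _).symm.trans_le
      (intervalIntegral.norm_integral_le_of_norm_le_const fun t ht => ?_)
    exact hΓ t (hsub ht)
  have hp : |(∫ t in b..a, curv q t) + ∫ t in b..a, curv qt t| ≤ (2 * K + Γ) * |a - b| := by
    rw [← intervalIntegral.integral_add hi hit]
    refine (Real.norm_eq_abs _).symm.trans_le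
      (intervalIntegral.norm_integral_le_of_norm_le_const fun t ht => ?_)
    have h1 := abs_le.1 (hK t (hsub ht))
    have h2 := abs_le.1 (hΓ t (hsub ht))
    exact abs_le.2 ⟨by linarith, by linarith⟩
  rw [dot2_deriv_eq_cos hL hq hu ha hb, dot2_deriv_eq_cos hL hqt hut ha hb]
  refine (abs_cos_sub_cos_le _ _).trans ?_
  have := mul_le_mul hp hm (abs_nonneg _) ((abs_nonneg _).trans hp)
  linarith

/-- Integrating a bound on tangent correlations twice bounds the difference of squared chords. -/
theorem abs_dot2_chord_sub_le {S : Set ℝ} (hS : S.OrdConnected) {M : ℝ} (hM : 0 ≤ M)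
    {q qt : ℝ → ℝ × ℝ}
    (hq : ContDiff ℝ 3 q) (hqt : ContDiff ℝ 3 qt)
    (h : ∀ a ∈ S, ∀ b ∈ S,
      |dot2 (deriv q a) (deriv q b) - dot2 (deriv qt a) (deriv qt b)| ≤ M * |a - b| ^ 2)
    {a b : ℝ} (ha : a ∈ S) (hb : b ∈ S) :
    |dot2 (q a - q b) (q a - q b) - dot2 (qt a - qt b) (qt a - qt b)|
      ≤ 2 * M * |a - b| ^ 4 := by
  have hG : ∀ s ∈ S, |dot2 (deriv q s) (q s - q b) - dot2 (deriv qt s) (qt s - qt b)|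
      ≤ M * |s - b| ^ 3 := by
    intro s hs
    have := (convex_uIcc s b).norm_image_sub_le_of_norm_hasDerivWithin_le
      (f := fun r => dot2 (deriv q s) (q s - q r) - dot2 (deriv qt s) (qt s - qt r))
      (f' := fun r => -(dot2 (deriv q s) (deriv q r) - dot2 (deriv qt s) (deriv qt r)))
      (C := M * |s - b| ^ 2) (fun r _ => by
        obtain ⟨h1, h2⟩ := hasDerivAt_fst_snd hq r
        obtain ⟨k1, k2⟩ := hasDerivAt_fst_snd hqt r
        exact (((((h1.const_sub (q s).1).const_mul (deriv q s).1).add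
          ((h2.const_sub (q s).2).const_mul (deriv q s).2)).sub
          (((k1.const_sub (qt s).1).const_mul (deriv qt s).1).add
          ((k2.const_sub (qt s).2).const_mul (deriv qt s).2))).congr_deriv (by
            simp only [dot2]; ring)).hasDerivWithinAt)
      (fun r hr => by
        rw [norm_neg]
        refine (h s hs r (hS.uIcc_subset hs hb hr)).trans ?_
        have := Set.abs_sub_left_of_mem_uIcc hr
        rw [abs_sub_comm r s, abs_sub_comm b s] at this
        gcongr) Set.left_mem_uIcc Set.right_mem_uIcc
    simp only [sub_self, Real.norm_eq_abs] at this
    rw [abs_sub_comm b s] at this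
    simp only [dot2, Prod.fst_zero, Prod.snd_zero, mul_zero, add_zero, sub_zero] at this ⊢
    exact this.trans_eq (by ring)
  have := (convex_uIcc b a).norm_image_sub_le_of_norm_hasDerivWithin_le
    (f := fun s => dot2 (q s - q b) (q s - q b) - dot2 (qt s - qt b) (qt s - qt b))
    (f' := fun s => 2 * (dot2 (deriv q s) (q s - q b) - dot2 (deriv qt s) (qt s - qt b)))
    (C := 2 * (M * |a - b| ^ 3)) (fun s _ => by
      obtain ⟨h1, h2⟩ := hasDerivAt_fst_snd hq s
      obtain ⟨k1, k2⟩ := hasDerivAt_fst_snd hqt s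
      have h1 := h1.sub_const (q b).1
      have h2 := h2.sub_const (q b).2
      have k1 := k1.sub_const (qt b).1
      have k2 := k2.sub_const (qt b).2
      exact ((((h1.mul h1).add (h2.mul h2)).sub ((k1.mul k1).add (k2.mul k2))).congr_deriv (by
          simp only [dot2, Prod.fst_sub, Prod.snd_sub]; ring)).hasDerivWithinAt)
    (fun s hs => by
      rw [norm_mul, Real.norm_eq_abs, abs_two]
      have h1 := hG s (hS.uIcc_subset hb ha hs)
      have := Set.abs_sub_left_of_mem_uIcc hs
      refine mul_le_mul_of_nonneg_left (h1.trans ?_) (by norm_num)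
      gcongr) Set.left_mem_uIcc Set.right_mem_uIcc
  simp only [sub_self, Real.norm_eq_abs] at this
  simp only [dot2, sub_zero] at this ⊢
  exact this.trans_eq (by ring)

theorem abs_log_sub_log_le {m x y : ℝ} (hm : 0 < m) (hx : m ≤ x) (hy : m ≤ y) :
    |Real.log x - Real.log y| ≤ |x - y| / m := by
  wlog h : y ≤ x generalizing x y
  · rw [abs_sub_comm, abs_sub_comm x y]
    exact this hy hx (le_of_not_ge h)
  have hy0 := hm.trans_le hy
  have hx0 := hm.trans_le hx
  rw [abs_of_nonneg (sub_nonneg.2 (Real.log_le_log hy0 h)), abs_of_nonneg (sub_nonneg.2 h),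
    ← Real.log_div hx0.ne' hy0.ne']
  calc Real.log (x / y) ≤ x / y - 1 := Real.log_le_sub_one_of_pos (by positivity)
    _ = (x - y) / y := by field_simp
    _ ≤ (x - y) / m := div_le_div_of_nonneg_left (sub_nonneg.2 h) hm hy

theorem log_enorm2 (v : ℝ × ℝ) : Real.log (enorm2 v) = Real.log (dot2 v v) / 2 := by
  rw [enorm2, Real.log_sqrt (by positivity), dot2]
  ring_nf

theorem sq_le_dot2_self {r : ℝ} (hr : 0 ≤ r) {v : ℝ × ℝ} (h : r ≤ enorm2 v) :
    r ^ 2 ≤ dot2 v v := by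
  have := (Real.le_sqrt hr (by positivity)).1 h
  simpa only [dot2, ← sq] using this

/-- **Bound (8.19) of Proposition 8.9.** There are constants `C > 0` and `δ > 0` depending only
on `K`, `L` and `c₀` such that for any two `C³` unit-speed curves `q, q̃ : [0,L] → ℝ²` with
signed curvatures `γ, γ̃` satisfying `|γ| ≤ K`, the chord–arc bounds
`|q(s) - q(s')| ≥ c₀|s - s'|` and `|q̃(s) - q̃(s')| ≥ c₀|s - s'|`, and
`sup|γ - γ̃| + sup|γ' - γ̃'| ≤ Γ₁ ≤ δ`, one has for all `s ≠ s'` in `[0,L]`: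
`|log|q(s) - q(s')| - log|q̃(s) - q̃(s')|| ≤ CΓ₁|s - s'|²`. -/
theorem stmt19 (L K c₀ : ℝ) (hL : 0 < L) (hK : 0 ≤ K) (hc₀ : 0 < c₀) :
    ∃ C > 0, ∃ δ > 0, ∀ (q qt : ℝ → ℝ × ℝ) (Γ₁ : ℝ),
      ContDiff ℝ 3 q → ContDiff ℝ 3 qt →
      (∀ s ∈ Set.Icc (0 : ℝ) L, enorm2 (deriv q s) = 1) →
      (∀ s ∈ Set.Icc (0 : ℝ) L, enorm2 (deriv qt s) = 1) →
      (∀ s ∈ Set.Icc (0 : ℝ) L, |curv q s| ≤ K) →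
      (∀ s ∈ Set.Icc (0 : ℝ) L, ∀ s' ∈ Set.Icc (0 : ℝ) L,
        c₀ * |s - s'| ≤ enorm2 (q s - q s')) →
      (∀ s ∈ Set.Icc (0 : ℝ) L, ∀ s' ∈ Set.Icc (0 : ℝ) L,
        c₀ * |s - s'| ≤ enorm2 (qt s - qt s')) →
      (∀ s ∈ Set.Icc (0 : ℝ) L, ∀ s' ∈ Set.Icc (0 : ℝ) L,
        |curv q s - curv qt s| + |deriv (curv q) s' - deriv (curv qt) s'| ≤ Γ₁) →
      Γ₁ ≤ δ →
      ∀ s ∈ Set.Icc (0 : ℝ) L, ∀ s' ∈ Set.Icc (0 : ℝ) L, s ≠ s' →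
        |Real.log (enorm2 (q s - q s')) - Real.log (enorm2 (qt s - qt s'))|
          ≤ C * Γ₁ * |s - s'| ^ 2 := by
  refine ⟨(2 * K + 1) / (2 * c₀ ^ 2), by positivity, 1, one_pos, ?_⟩
  intro q qt Γ hq hqt hu hut hγ hc hct hΓ hΓ1 s hs s' hs' hne
  have hd : 0 < |s - s'| := abs_pos.2 (sub_ne_zero.2 hne)
  have hΓs : ∀ s ∈ Set.Icc (0 : ℝ) L, |curv q s - curv qt s| ≤ Γ := fun s hs =>
    (le_add_of_nonneg_right (abs_nonneg _)).trans (hΓ s hs s hs)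
  have hΓ0 : 0 ≤ Γ := (abs_nonneg _).trans (hΓs s hs)
  have hchord := abs_dot2_chord_sub_le Set.ordConnected_Icc (by positivity) hq hqt
    (fun a ha b hb => abs_dot2_deriv_sub_le hL hq hqt hu hut hγ hΓs ha hb) hs hs'
  have hr : 0 < c₀ * |s - s'| := by positivity
  have hlog := abs_log_sub_log_le (sq_pos_of_pos hr)
    (sq_le_dot2_self hr.le (hc s hs s' hs')) (sq_le_dot2_self hr.le (hct s hs s' hs'))
  rw [log_enorm2, log_enorm2, ← sub_div, abs_div, abs_two]
  calc _ ≤ (2 * ((2 * K + Γ) / 2 * Γ) * |s - s'| ^ 4) / (c₀ * |s - s'|) ^ 2 / 2 := by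
        refine div_le_div_of_nonneg_right (hlog.trans ?_) (by norm_num)
        exact div_le_div_of_nonneg_right hchord (by positivity)
    _ = (2 * K + Γ) / (2 * c₀ ^ 2) * Γ * |s - s'| ^ 2 := by field_simp
    _ ≤ _ := by gcongr
end
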